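/- Let r be a positive integer, a > 0, and let D ⊆ ℂ^r be an open set containing the real cube [-a,a]^r. Let p and q be holomorphic functions on D, and for each positive integer n set I(n) = ∫_{[-a,a]^r} e^{-n p(t)} q(t) dt (integration over the real cube, t = (t_1,…,t_r)). Assume: (i) the complex gradient of p vanishes at t = 0 and the complex Hessian matrix Hess p(0) of p at 0 has nonzero determinant; (ii) the real-valued function t ↦ Re p(t) on [-a,a]^r attains its minimum only at the point t = 0; (iii) the real part of Hess p(0) (the real symmetric matrix of entrywise real parts) has nonzero determinant; and (iv) q(0) ≠ 0. Then there is a complex number w with w² = det Hess p(0) such that I(n) ∼ (2π/n)^{r/2} · e^{-n p(0)} · q(0)/w as n → ∞, i.e. the quotient of I(n) by the right-hand side tends to 1. -/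

import Mathlib

open MeasureTheory Filter Matrix

/-- Cauchy estimate for the Frechet derivative. -/
lemma sp_fderiv_bound {r : ℕ} (f : (Fin r → ℂ) → ℂ) (x : Fin r → ℂ) (ε M : ℝ) (hε : 0 < ε)
    (hM : 0 ≤ M)
    (hf : ∀ y ∈ Metric.closedBall x ε, DifferentiableAt ℂ f y)
    (hb : ∀ y ∈ Metric.closedBall x ε, ‖f y‖ ≤ M) : ‖fderiv ℂ f x‖ ≤ M / ε := by
  refine ContinuousLinearMap.opNorm_le_bound _ (by positivity) fun u => ?_
  rcases eq_or_ne u 0 with rfl | hu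
  · simp
  have hun : 0 < ‖u‖ := norm_pos_iff.2 hu
  set R := ε / ‖u‖ with hR
  have hRpos : 0 < R := by positivity
  have hmem : ∀ z ∈ Metric.closedBall (0 : ℂ) R, x + z • u ∈ Metric.closedBall x ε := by
    intro z hz
    rw [mem_closedBall_zero_iff, hR, le_div_iff₀ hun] at hz
    simpa [Metric.mem_closedBall, dist_eq_norm, norm_smul] using hz
  have hline : ∀ z : ℂ, HasDerivAt (fun z : ℂ => x + z • u) u z := by
    intro z
    simpa using ((hasDerivAt_id z).smul_const u).const_add x
  have hd : ∀ z ∈ Metric.closedBall (0 : ℂ) R,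
      HasDerivAt (fun z : ℂ => f (x + z • u)) (fderiv ℂ f (x + z • u) u) z := fun z hz =>
    (hf _ (hmem z hz)).hasFDerivAt.comp_hasDerivAt z (hline z)
  have h0 := (hd 0 (by simp [hRpos.le])).deriv
  have := Complex.norm_deriv_le_of_forall_mem_sphere_norm_le (C := M) hRpos
    (f := fun z : ℂ => f (x + z • u)) (c := 0)
    (DifferentiableOn.diffContOnCl (by
      rw [closure_ball _ hRpos.ne']
      exact fun z hz => (hd z hz).differentiableAt.differentiableWithinAt))
    (fun z hz => hb _ (hmem z (Metric.sphere_subset_closedBall hz)))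
  rw [h0] at this
  simp only [zero_smul, add_zero] at this
  refine this.trans (le_of_eq ?_)
  rw [hR]; field_simp

lemma sp_fderiv_apply_diff {r : ℕ} (D : Set (Fin r → ℂ)) (hD : IsOpen D)
    (f : (Fin r → ℂ) → ℂ) (hf : DifferentiableOn ℂ f D) (x₀ : Fin r → ℂ) (hx₀ : x₀ ∈ D)
    (v : Fin r → ℂ) : DifferentiableAt ℂ (fun x => fderiv ℂ f x v) x₀ := by
  have hfd : ∀ y ∈ D, DifferentiableAt ℂ f y := fun y hy => hf.differentiableAt (hD.mem_nhds hy)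
  have hcont : ContinuousAt f x₀ := (hfd x₀ hx₀).continuousAt
  obtain ⟨δ, hδ, hball⟩ : ∃ δ > 0, ∀ y ∈ Metric.ball x₀ δ, y ∈ D ∧ ‖f y‖ ≤ ‖f x₀‖ + 1 := by
    have h1 : ∀ᶠ y in nhds x₀, y ∈ D ∧ ‖f y‖ ≤ ‖f x₀‖ + 1 := by
      filter_upwards [hD.mem_nhds hx₀, hcont.norm.eventually (gt_mem_nhds (lt_add_one _))]
        with y h1 h2 using ⟨h1, h2.le⟩
    obtain ⟨δ, hδ, h⟩ := Metric.eventually_nhds_iff_ball.1 h1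
    exact ⟨δ, hδ, h⟩
  set M := ‖f x₀‖ + 1
  have hM : 0 ≤ M := by positivity
  set ε := δ / 4 with hε
  have hεpos : 0 < ε := by positivity
  set ρ := ε / (‖v‖ + 1) with hρ
  have hρpos : 0 < ρ := by positivity
  have hρv : ρ * ‖v‖ ≤ ε := by
    rw [hρ, div_mul_eq_mul_div, div_le_iff₀ (by positivity)]
    nlinarith [norm_nonneg v]
  have hmem : ∀ x ∈ Metric.ball x₀ ε, ∀ z ∈ Metric.closedBall (0 : ℂ) ρ,
      x + z • v ∈ Metric.ball x₀ (2 * ε) := by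
    intro x hx z hz
    rw [mem_closedBall_zero_iff] at hz
    rw [mem_ball_iff_norm] at hx ⊢
    have : x + z • v - x₀ = (x - x₀) + z • v := by abel
    rw [this]
    have h2 := norm_add_le (x - x₀) (z • v)
    rw [norm_smul] at h2
    nlinarith [mul_le_mul_of_nonneg_right hz (norm_nonneg v)]
  have hsub : Metric.ball x₀ (2 * ε) ⊆ Metric.ball x₀ δ :=
    Metric.ball_subset_ball (by linarith)
  have hfb : ∀ y ∈ Metric.ball x₀ (2 * ε), ‖fderiv ℂ f y‖ ≤ M / ε := by
    intro y hy
    have hsub2 : Metric.closedBall y ε ⊆ Metric.ball x₀ δ := by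
      intro z hz
      rw [Metric.mem_closedBall] at hz
      rw [Metric.mem_ball] at hy ⊢
      linarith [dist_triangle z y x₀]
    exact sp_fderiv_bound f y ε M hεpos hM (fun z hz => hfd z (hball z (hsub2 hz)).1)
      (fun z hz => (hball z (hsub2 hz)).2)
  -- Cauchy formula
  have hcauchy : ∀ x ∈ Metric.ball x₀ ε, fderiv ℂ f x v = (2 * Real.pi * Complex.I : ℂ)⁻¹ •
      ∮ z in C(0, ρ), ((z - 0) ^ 2)⁻¹ • f (x + z • v) := by
    intro x hx
    have hline : ∀ z : ℂ, HasDerivAt (fun z : ℂ => x + z • v) v z := by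
      intro z
      simpa using ((hasDerivAt_id z).smul_const v).const_add x
    have hU : IsOpen ((fun z : ℂ => x + z • v) ⁻¹' D) :=
      hD.preimage (by fun_prop)
    have hd : ∀ z ∈ ((fun z : ℂ => x + z • v) ⁻¹' D),
        HasDerivAt (fun z : ℂ => f (x + z • v)) (fderiv ℂ f (x + z • v) v) z := fun z hz =>
      (hfd _ hz).hasFDerivAt.comp_hasDerivAt z (hline z)
    have hsubU : Metric.closedBall (0 : ℂ) ρ ⊆ ((fun z : ℂ => x + z • v) ⁻¹' D) := fun z hz =>
      (hball _ (hsub (hmem x hx z hz))).1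
    rw [Complex.two_pi_I_inv_smul_circleIntegral_sub_sq_inv_smul_of_differentiable hU
      hsubU (fun z hz => (hd z hz).differentiableAt.differentiableWithinAt)
      (Metric.mem_ball_self hρpos), (hd 0 (hsubU (by simp [hρpos.le]))).deriv]
    simp
  have hcm : ∀ θ : ℝ, circleMap 0 ρ θ ∈ Metric.closedBall (0 : ℂ) ρ := fun θ =>
    circleMap_mem_closedBall _ hρpos.le θ
  set k : ℝ → ℂ := fun θ => deriv (circleMap 0 ρ) θ * ((circleMap 0 ρ θ - 0) ^ 2)⁻¹ with hk
  have hkc : Continuous k := by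
    have h1 : ∀ θ, (circleMap 0 ρ θ - 0) ^ 2 ≠ 0 := fun θ => by
      simp [hρpos.ne']
    simp only [hk, deriv_circleMap]
    exact ((continuous_circleMap 0 ρ).mul continuous_const).mul
      ((((continuous_circleMap 0 ρ).sub continuous_const).pow 2).inv₀ h1)
  have hFc : ∀ x ∈ Metric.ball x₀ ε, Continuous fun θ : ℝ => k θ * f (x + circleMap 0 ρ θ • v) := by
    intro x hx
    refine hkc.mul ?_
    refine continuous_iff_continuousAt.2 fun θ => ?_
    have h1 : ContinuousAt f (x + circleMap 0 ρ θ • v) :=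
      (hfd _ (hball _ (hsub (hmem x hx _ (hcm θ)))).1).continuousAt
    have h2 : Continuous fun θ : ℝ => x + circleMap 0 ρ θ • v :=
      continuous_const.add ((continuous_circleMap 0 ρ).smul continuous_const)
    exact ContinuousAt.comp (f := fun θ : ℝ => x + circleMap 0 ρ θ • v) h1 h2.continuousAt
  have hint := intervalIntegral.hasFDerivAt_integral_of_dominated_of_fderiv_le (𝕜 := ℂ)
    (μ := volume) (a := 0) (b := 2 * Real.pi)
    (F := fun x θ => k θ * f (x + circleMap 0 ρ θ • v))
    (F' := fun x θ => k θ • fderiv ℂ f (x + circleMap 0 ρ θ • v))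
    (bound := fun θ => ‖k θ‖ * (M / ε))
    (x₀ := x₀) (s := Metric.ball x₀ ε) (Metric.ball_mem_nhds _ hεpos)
    (by
      filter_upwards [Metric.ball_mem_nhds x₀ hεpos] with x hx
      exact (hFc x hx).aestronglyMeasurable)
    ((hFc x₀ (Metric.mem_ball_self hεpos)).intervalIntegrable _ _)
    (by
      refine AEStronglyMeasurable.smul hkc.aestronglyMeasurable ?_
      have h2 : Continuous fun θ : ℝ => x₀ + circleMap 0 ρ θ • v :=
        continuous_const.add ((continuous_circleMap 0 ρ).smul continuous_const)
      have := (measurable_fderiv ℂ f).comp h2.measurable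
      exact this.stronglyMeasurable.aestronglyMeasurable)
    (by
      refine Eventually.of_forall fun θ _ x hx => ?_
      rw [norm_smul]
      exact mul_le_mul_of_nonneg_left (hfb _ (hmem x hx _ (hcm θ))) (norm_nonneg _))
    ((hkc.norm.mul continuous_const).intervalIntegrable _ _)
    (by
      refine Eventually.of_forall fun θ _ x hx => ?_
      have h1 := (hfd _ (hball _ (hsub (hmem x hx _ (hcm θ)))).1).hasFDerivAt
      have h3 : HasFDerivAt (fun x => f (x + circleMap 0 ρ θ • v))
          (fderiv ℂ f (x + circleMap 0 ρ θ • v)) x := by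
        exact (h1.comp x ((hasFDerivAt_id x).add_const (circleMap 0 ρ θ • v))).congr_fderiv
          (by ext w; rfl)
      exact h3.const_mul (k θ))
  refine DifferentiableAt.congr_of_eventuallyEq
    (hint.differentiableAt.const_mul (2 * Real.pi * Complex.I : ℂ)⁻¹) ?_
  filter_upwards [Metric.ball_mem_nhds x₀ hεpos] with x hx
  rw [hcauchy x hx, circleIntegral, smul_eq_mul]
  congr 1
  refine intervalIntegral.integral_congr fun θ _ => ?_
  simp [hk, mul_assoc]

lemma sp_fderiv_diff {r : ℕ} (D : Set (Fin r → ℂ)) (hD : IsOpen D)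
    (f : (Fin r → ℂ) → ℂ) (hf : DifferentiableOn ℂ f D) (x₀ : Fin r → ℂ) (hx₀ : x₀ ∈ D) :
    DifferentiableAt ℂ (fderiv ℂ f) x₀ := by
  have : fderiv ℂ f = fun x => ∑ j : Fin r, (fderiv ℂ f x (Pi.single j 1)) •
      (ContinuousLinearMap.proj (R := ℂ) (φ := fun _ : Fin r => ℂ) j) := by
    ext x v
    simp [mul_comm]
    conv_lhs => rw [pi_eq_sum_univ' v]
    simp [map_sum]
  rw [this]
  refine DifferentiableAt.fun_sum fun j _ => ?_
  exact (sp_fderiv_apply_diff D hD f hf x₀ hx₀ _).smul_const _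

/-- Second-order Taylor expansion. -/
lemma sp_taylor {r : ℕ} (D : Set (Fin r → ℂ)) (hD : IsOpen D)
    (p : (Fin r → ℂ) → ℂ) (hp : DifferentiableOn ℂ p D) (h0 : (0 : Fin r → ℂ) ∈ D)
    (hgrad : ∀ j : Fin r, fderiv ℂ p 0 (Pi.single j 1) = 0)
    (Hess : Matrix (Fin r) (Fin r) ℂ)
    (hHess : ∀ i j : Fin r,
      Hess i j = fderiv ℂ (fun x => fderiv ℂ p x (Pi.single j 1)) 0 (Pi.single i 1)) :
    Hess.IsSymm ∧ ∀ ε > 0, ∃ δ > 0, ∀ x : Fin r → ℂ, ‖x‖ < δ →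
      ‖p x - p 0 - (1 / 2) * (x ⬝ᵥ Hess *ᵥ x)‖ ≤ ε * ‖x‖ ^ 2 := by
  have hd := (sp_fderiv_diff D hD p hp 0 h0).hasFDerivAt
  set B := fderiv ℂ (fderiv ℂ p) 0 with hB
  have hev : ∀ᶠ y in nhds (0 : Fin r → ℂ), HasFDerivAt p (fderiv ℂ p y) y := by
    filter_upwards [hD.mem_nhds h0] with y hy
    exact (hp.differentiableAt (hD.mem_nhds hy)).hasFDerivAt
  have hsymm := second_derivative_symmetric_of_eventually hev hd
  have hH : ∀ i j, Hess i j = B (Pi.single i 1) (Pi.single j 1) := by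
    intro i j
    rw [hHess]
    have h1 : HasFDerivAt (fun x => fderiv ℂ p x (Pi.single j 1))
      ((ContinuousLinearMap.apply ℂ ℂ (Pi.single j (1 : ℂ) : Fin r → ℂ)).comp B) 0 :=
      (ContinuousLinearMap.apply ℂ ℂ (Pi.single j (1 : ℂ) : Fin r → ℂ)).hasFDerivAt.comp 0 hd
    rw [h1.fderiv]; simp
  have hquad : ∀ x, x ⬝ᵥ Hess *ᵥ x = B x x := by
    intro x
    have hx := pi_eq_sum_univ' x
    conv_rhs => rw [hx]
    simp only [map_sum, map_smul, _root_.sum_apply, _root_.smul_apply,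
      dotProduct, Matrix.mulVec, hH, Finset.mul_sum, smul_eq_mul]
    rw [Finset.sum_comm]
    refine Finset.sum_congr rfl fun i _ => Finset.sum_congr rfl fun j _ => ?_
    ring
  have hf0 : fderiv ℂ p 0 = 0 := by
    ext v
    conv_lhs => rw [pi_eq_sum_univ' v]
    simp [map_sum, hgrad]
  refine ⟨?_, ?_⟩
  · ext i j
    rw [Matrix.transpose_apply, hH, hH]; exact hsymm _ _
  intro ε hε
  have h1 := (hasFDerivAt_iff_isLittleO_nhds_zero.1 hd).def hε
  obtain ⟨δ, hδ, hb⟩ := Metric.eventually_nhds_iff_ball.1 (h1.and hev)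
  refine ⟨δ, hδ, fun x hx => ?_⟩
  have hseg : ∀ y ∈ Metric.closedBall (0 : Fin r → ℂ) ‖x‖,
      HasFDerivAt (fun y => p y - (1 / 2) * B y y) (fderiv ℂ p y - B y) y := by
    intro y hy
    have hy' : y ∈ Metric.ball (0 : Fin r → ℂ) δ := by
      rw [mem_ball_zero_iff]; rw [mem_closedBall_zero_iff] at hy; linarith
    have hBB : HasFDerivAt (fun y => B y y) (B y + B.flip y) y := by
      have := B.hasFDerivAt (x := y) |>.clm_apply (hasFDerivAt_id y)
      exact this.congr_fderiv (by ext w; rfl)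
    have := (hb y hy').2.sub (hBB.const_mul (1 / 2 : ℂ))
    refine this.congr_fderiv ?_
    ext v
    simp only [_root_.sub_apply, _root_.add_apply, _root_.smul_apply,
      ContinuousLinearMap.flip_apply, smul_eq_mul, hsymm v y]
    ring
  have := Convex.norm_image_sub_le_of_norm_hasFDerivWithin_le (𝕜 := ℂ)
    (s := Metric.closedBall (0 : Fin r → ℂ) ‖x‖) (C := ε * ‖x‖) (x := 0) (y := x)
    (f := fun y => p y - (1 / 2) * B y y) (f' := fun y => fderiv ℂ p y - B y)
    (fun y hy => (hseg y hy).hasFDerivWithinAt) (fun y hy => ?_)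
    (convex_closedBall _ _) (by simp) (by simp)
  · rw [hquad]
    simp only [map_zero, mul_zero, sub_zero] at this
    calc _ = ‖p x - 1 / 2 * (B x) x - p 0‖ := by congr 1; ring
      _ ≤ _ := this
      _ = _ := by ring
  · have hy' : y ∈ Metric.ball (0 : Fin r → ℂ) δ := by
      rw [mem_ball_zero_iff]; rw [mem_closedBall_zero_iff] at hy; linarith
    have := (hb y hy').1
    simp only [zero_add, hf0, sub_zero] at this
    rw [mem_closedBall_zero_iff] at hy
    exact this.trans (mul_le_mul_of_nonneg_left hy hε.le)

lemma sp_simdiag {r : ℕ} (A B : Matrix (Fin r) (Fin r) ℝ) (hA : A.PosDef) (hB : B.IsSymm) :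
    ∃ (P : Matrix (Fin r) (Fin r) ℝ) (l : Fin r → ℝ),
      Pᵀ * A * P = 1 ∧ Pᵀ * B * P = diagonal l := by
  have key : ∀ C : Matrix (Fin r) (Fin r) ℝ, ∀ hC : C.IsHermitian,
      ∃ U : Matrix (Fin r) (Fin r) ℝ, Uᵀ * U = 1 ∧ Uᵀ * C * U = diagonal hC.eigenvalues := by
    intro C hC
    refine ⟨(hC.eigenvectorUnitary : Matrix (Fin r) (Fin r) ℝ), ?_, ?_⟩
    · have := Unitary.coe_star_mul_self hC.eigenvectorUnitary
      rwa [Matrix.star_eq_conjTranspose, Matrix.conjTranspose_eq_transpose_of_trivial] at this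
    · have := hC.conjStarAlgAut_star_eigenvectorUnitary
      rw [Unitary.conjStarAlgAut_apply] at this
      simp only [Unitary.coe_star, star_star] at this
      rw [Matrix.star_eq_conjTranspose, Matrix.conjTranspose_eq_transpose_of_trivial] at this
      exact this
  obtain ⟨U, hU, hUA⟩ := key A hA.1
  set d := hA.1.eigenvalues with hd
  have hdpos : ∀ i, 0 < d i := fun i => hA.eigenvalues_pos i
  set S : Matrix (Fin r) (Fin r) ℝ := diagonal (fun i => (Real.sqrt (d i))⁻¹) with hS
  have hST : Sᵀ = S := by simp [hS]
  set R := U * S with hR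
  have hRA : Rᵀ * A * R = 1 := by
    have : Rᵀ * A * R = S * (Uᵀ * A * U) * S := by
      rw [hR, Matrix.transpose_mul, hST]; simp only [Matrix.mul_assoc]
    rw [this, hUA, hS, Matrix.diagonal_mul_diagonal, Matrix.diagonal_mul_diagonal,
      ← Matrix.diagonal_one]
    congr 1
    ext i
    have h1 := Real.mul_self_sqrt (hdpos i).le
    have h2 : Real.sqrt (d i) ≠ 0 := (Real.sqrt_pos.2 (hdpos i)).ne'
    field_simp
    nlinarith
  have hBh : (Rᵀ * B * R).IsHermitian := by
    rw [Matrix.IsHermitian, Matrix.conjTranspose_eq_transpose_of_trivial]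
    simp only [Matrix.transpose_mul, Matrix.transpose_transpose, hB.eq, Matrix.mul_assoc]
  obtain ⟨V, hV, hVB⟩ := key _ hBh
  refine ⟨R * V, hBh.eigenvalues, ?_, ?_⟩
  · have : (R * V)ᵀ * A * (R * V) = Vᵀ * (Rᵀ * A * R) * V := by
      simp only [Matrix.transpose_mul, Matrix.mul_assoc]
    rw [this, hRA, Matrix.mul_one, hV]
  · rw [← hVB]
    simp only [Matrix.transpose_mul, Matrix.mul_assoc]

/-- The (squared) complex Gaussian integral. -/
lemma sp_gauss {r : ℕ} (H : Matrix (Fin r) (Fin r) ℂ) (hH : H.IsSymm)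
    (hre : (H.map Complex.re).PosDef) :
    (∫ s : Fin r → ℝ, Complex.exp (-(1 / 2) * ((fun j => (s j : ℂ)) ⬝ᵥ H *ᵥ (fun j => (s j : ℂ))))) ^ 2
      * H.det = (2 * Real.pi) ^ r := by
  have hBs : (H.map Complex.im).IsSymm := by
    ext i j
    simpa using congrArg Complex.im (hH.apply i j)
  obtain ⟨P, l, hPA, hPB⟩ := sp_simdiag _ _ hre hBs
  set Pc : Matrix (Fin r) (Fin r) ℂ := P.map Complex.ofRealHom with hPc
  have hdec : H = (H.map Complex.re).map Complex.ofRealHom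
      + Complex.I • (H.map Complex.im).map Complex.ofRealHom := by
    ext i j
    simp [mul_comm Complex.I, Complex.re_add_im]
  have hdiag : Pcᵀ * H * Pc = diagonal (fun j => 1 + Complex.I * l j) := by
    have e1 : Pcᵀ * (H.map Complex.re).map Complex.ofRealHom * Pc = 1 := by
      have := congrArg (fun M : Matrix (Fin r) (Fin r) ℝ => M.map Complex.ofRealHom) hPA
      simpa only [Matrix.map_mul, Matrix.transpose_map, hPc,
        Matrix.map_one _ (map_zero Complex.ofRealHom) (map_one Complex.ofRealHom)] using this
    have e2 : Pcᵀ * (H.map Complex.im).map Complex.ofRealHom * Pc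
        = diagonal (fun j => (l j : ℂ)) := by
      have := congrArg (fun M : Matrix (Fin r) (Fin r) ℝ => M.map Complex.ofRealHom) hPB
      simp only [Matrix.map_mul,
        Matrix.diagonal_map (map_zero Complex.ofRealHom)] at this
      exact this
    conv_lhs => rw [hdec]
    rw [Matrix.mul_add, Matrix.add_mul, e1, Matrix.mul_smul, Matrix.smul_mul, e2]
    ext i j
    by_cases hij : i = j
    · subst hij; simp
    · simp [hij]
  have hdetP : P.det ≠ 0 := by
    intro h
    have := congrArg Matrix.det hPA
    simp [h] at this
  have hdetPc : Pc.det = (P.det : ℂ) := by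
    rw [hPc]
    exact (RingHom.map_det Complex.ofRealHom P).symm
  have hdet : (P.det : ℂ) ^ 2 * H.det = ∏ j, (1 + Complex.I * l j) := by
    have := congrArg Matrix.det hdiag
    rw [Matrix.det_mul, Matrix.det_mul, Matrix.det_transpose, hdetPc, Matrix.det_diagonal] at this
    rw [← this]; ring
  set f : (Fin r → ℝ) → ℂ := fun s =>
    Complex.exp (-(1 / 2) * ((fun j => (s j : ℂ)) ⬝ᵥ H *ᵥ (fun j => (s j : ℂ)))) with hf
  have hfc : Continuous f := by
    rw [hf]
    simp only [dotProduct, Matrix.mulVec]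
    fun_prop
  have hfP : ∀ u, f (Matrix.toLin' P u)
      = ∏ j, Complex.exp (-((1 + Complex.I * l j) / 2) * (u j : ℂ) ^ 2) := by
    intro u
    have h1 : (fun j => ((Matrix.toLin' P u) j : ℂ)) = Pc *ᵥ (fun j => (u j : ℂ)) := by
      ext j
      simp [Matrix.mulVec, dotProduct, hPc]
    simp only [hf, h1]
    rw [← Complex.exp_sum]
    congr 1
    rw [← Matrix.vecMul_transpose, ← Matrix.dotProduct_mulVec, Matrix.vecMul_transpose,
      Matrix.mulVec_mulVec, Matrix.mulVec_mulVec, hdiag]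
    simp only [dotProduct, Matrix.mulVec_diagonal, Finset.mul_sum]
    refine Finset.sum_congr rfl fun j _ => ?_
    ring
  have hcv : ∫ u, f (Matrix.toLin' P u) = ((|P.det|⁻¹ : ℝ) : ℂ) * ∫ s, f s := by
    have hm := Real.map_matrix_volume_pi_eq_smul_volume_pi hdetP
    have hcont : Continuous (Matrix.toLin' P) := LinearMap.continuous_of_finiteDimensional _
    rw [← integral_map (φ := Matrix.toLin' P) hcont.aemeasurable hfc.aestronglyMeasurable, hm,
      integral_smul_measure, ENNReal.toReal_ofReal (abs_nonneg _), abs_inv, Complex.real_smul]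
  have hprod : ∫ u, f (Matrix.toLin' P u)
      = ∏ j, ((Real.pi : ℂ) / ((1 + Complex.I * l j) / 2)) ^ (1 / 2 : ℂ) := by
    simp_rw [hfP]
    rw [integral_fintype_prod_volume_eq_prod
      (fun j (x : ℝ) => Complex.exp (-((1 + Complex.I * l j) / 2) * (x : ℂ) ^ 2))]
    refine Finset.prod_congr rfl fun j _ => ?_
    exact integral_gaussian_complex (by simp)
  have hne : ∀ j, (1 + Complex.I * l j) ≠ 0 := fun j h => by
    have := congrArg Complex.re h
    simp at this
  have hsq : (∫ u, f (Matrix.toLin' P u)) ^ 2 * ∏ j, (1 + Complex.I * l j)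
      = (2 * Real.pi) ^ r := by
    rw [hprod, ← Finset.prod_pow, ← Finset.prod_mul_distrib]
    have : ∀ j ∈ (Finset.univ : Finset (Fin r)),
        (((Real.pi : ℂ) / ((1 + Complex.I * l j) / 2)) ^ (1 / 2 : ℂ)) ^ 2 * (1 + Complex.I * l j)
        = 2 * Real.pi := by
      intro j _
      rw [← Complex.cpow_nat_mul]
      have := hne j
      norm_num
      field_simp
    rw [Finset.prod_congr rfl this]
    simp
  rw [hcv, ← hdet] at hsq
  rw [← hsq]
  have habs : ((|P.det| : ℝ) : ℂ) ^ 2 = (P.det : ℂ) ^ 2 := by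
    rw [← Complex.ofReal_pow, sq_abs, Complex.ofReal_pow]
  have : (P.det : ℂ) ≠ 0 := by exact_mod_cast hdetP
  rw [mul_pow, Complex.ofReal_inv, inv_pow, habs]
  field_simp

lemma sp_integrable {r : ℕ} (c : ℝ) (hc : 0 < c) :
    Integrable (fun s : Fin r → ℝ => Real.exp (-(c * ‖s‖ ^ 2))) := by
  have h1 : Integrable (fun s : Fin r → ℝ => ∏ j, Real.exp (-(c / (r + 1)) * (s j) ^ 2)) :=
    Integrable.fintype_prod (f := fun _ (x : ℝ) => Real.exp (-(c / (r + 1)) * x ^ 2))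
      fun _ => integrable_exp_neg_mul_sq (by positivity)
  refine h1.mono' (by fun_prop) (Eventually.of_forall fun s => ?_)
  rw [Real.norm_of_nonneg (Real.exp_pos _).le, ← Real.exp_sum, Real.exp_le_exp, ← Finset.mul_sum]
  have h2 : ∑ j, s j ^ 2 ≤ (r + 1) * ‖s‖ ^ 2 := by
    calc ∑ j, s j ^ 2 ≤ ∑ _j : Fin r, ‖s‖ ^ 2 := by
          refine Finset.sum_le_sum fun j _ => ?_
          rw [← sq_abs]
          exact pow_le_pow_left₀ (abs_nonneg _) (norm_le_pi_norm s j) 2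
      _ = r * ‖s‖ ^ 2 := by simp
      _ ≤ _ := by nlinarith [sq_nonneg ‖s‖]
  have h3 : c / (r + 1) * ∑ j, s j ^ 2 ≤ c / (r + 1) * ((r + 1) * ‖s‖ ^ 2) :=
    mul_le_mul_of_nonneg_left h2 (by positivity)
  have h4 : c / (r + 1) * ((r + 1) * ‖s‖ ^ 2) = c * ‖s‖ ^ 2 := by
    have : (r + 1 : ℝ) ≠ 0 := by positivity
    field_simp
  linarith

/-- the complexified quadratic form -/
noncomputable def spQ {r : ℕ} (H : Matrix (Fin r) (Fin r) ℂ) (t : Fin r → ℝ) : ℂ :=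
  (fun j => (t j : ℂ)) ⬝ᵥ H *ᵥ (fun j => (t j : ℂ))

lemma spQ_smul {r : ℕ} (H : Matrix (Fin r) (Fin r) ℂ) (k : ℝ) (t : Fin r → ℝ) :
    spQ H (k • t) = (k : ℂ) ^ 2 * spQ H t := by
  have : (fun j => ((k • t) j : ℂ)) = (k : ℂ) • (fun j => (t j : ℂ)) := by
    ext j; simp
  rw [spQ, this, Matrix.mulVec_smul, smul_dotProduct, dotProduct_smul, spQ, smul_eq_mul,
    smul_eq_mul]
  ring

lemma spQ_cont {r : ℕ} (H : Matrix (Fin r) (Fin r) ℂ) : Continuous (spQ H) := by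
  unfold spQ
  simp only [dotProduct, Matrix.mulVec]
  fun_prop

lemma spQ_re {r : ℕ} (H : Matrix (Fin r) (Fin r) ℂ) (t : Fin r → ℝ) :
    (spQ H t).re = t ⬝ᵥ (H.map Complex.re) *ᵥ t := by
  simp [spQ, dotProduct, Matrix.mulVec]

lemma sp_mem_cube {r : ℕ} (a : ℝ) (t : Fin r → ℝ) (h : ‖t‖ ≤ a) :
    t ∈ Set.Icc (fun _ : Fin r => -a) (fun _ => a) := by
  refine ⟨fun j => ?_, fun j => ?_⟩
  · exact (abs_le.1 ((norm_le_pi_norm t j).trans h)).1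
  · exact (abs_le.1 ((norm_le_pi_norm t j).trans h)).2

lemma sp_cube_norm {r : ℕ} (a : ℝ) (ha : 0 < a) (t : Fin r → ℝ)
    (h : t ∈ Set.Icc (fun _ : Fin r => -a) (fun _ => a)) : ‖t‖ ≤ a :=
  (pi_norm_le_iff_of_nonneg ha.le).2 fun j => abs_le.2 ⟨h.1 j, h.2 j⟩

lemma sp_posdef {r : ℕ} (a : ℝ) (ha : 0 < a) (φ : (Fin r → ℝ) → ℂ)
    (H : Matrix (Fin r) (Fin r) ℂ) (hH : H.IsSymm) (hdet : (H.map Complex.re).det ≠ 0)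
    (hT : ∀ ε > 0, ∃ δ > 0, ∀ t : Fin r → ℝ, ‖t‖ < δ →
      ‖φ t - (1 / 2) * spQ H t‖ ≤ ε * ‖t‖ ^ 2)
    (hmin : ∀ t ∈ Set.Icc (fun _ : Fin r => -a) (fun _ => a), t ≠ 0 → 0 < (φ t).re) :
    (H.map Complex.re).PosDef := by
  have hsymm : (H.map Complex.re).IsHermitian := by
    rw [Matrix.IsHermitian, Matrix.conjTranspose_eq_transpose_of_trivial]
    ext i j
    simpa using congrArg Complex.re (hH.apply i j)
  have hpsd : (H.map Complex.re).PosSemidef := by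
    refine Matrix.PosSemidef.of_dotProduct_mulVec_nonneg hsymm fun x => ?_
    simp only [star_trivial]
    rw [← spQ_re]
    rcases eq_or_ne x 0 with rfl | hx
    · rw [spQ_re]; simp
    have hxn : 0 < ‖x‖ := norm_pos_iff.2 hx
    by_contra hneg
    push Not at hneg
    obtain ⟨δ, hδ, hb⟩ := hT (-(spQ H x).re / (4 * ‖x‖ ^ 2))
      (div_pos (by linarith) (by positivity))
    set k := min (δ / 2) a / ‖x‖ with hk
    have hmpos : 0 < min (δ / 2) a := lt_min (by positivity) ha
    have hkpos : 0 < k := by positivity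
    have hkn : ‖k • x‖ = min (δ / 2) a := by
      rw [norm_smul, Real.norm_of_nonneg hkpos.le, hk]; field_simp
    have h1 := hb (k • x) (by rw [hkn]; linarith [min_le_left (δ / 2) a])
    have h2 := hmin (k • x) (sp_mem_cube a _ (by rw [hkn]; exact min_le_right _ _))
      (smul_ne_zero hkpos.ne' hx)
    have h3 := (Complex.abs_re_le_norm _).trans h1
    rw [spQ_smul] at h3
    have h4 : ((φ (k • x)) - 1 / 2 * ((k : ℂ) ^ 2 * spQ H x)).re
        = (φ (k • x)).re - 1 / 2 * (k ^ 2 * (spQ H x).re) := by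
      rw [← Complex.ofReal_pow, Complex.sub_re]
      congr 1
      rw [show (1 / 2 : ℂ) = ((1 / 2 : ℝ) : ℂ) by norm_num, Complex.re_ofReal_mul,
        Complex.re_ofReal_mul]
    rw [h4, norm_smul, Real.norm_of_nonneg hkpos.le] at h3
    have h5 := (abs_le.1 h3).2
    have h6 : -(spQ H x).re / (4 * ‖x‖ ^ 2) * (k * ‖x‖) ^ 2 = -(spQ H x).re / 4 * k ^ 2 := by
      field_simp
    rw [h6] at h5
    have : 0 < k ^ 2 := by positivity
    nlinarith
  exact hpsd.posDef_iff_det_ne_zero.2 hdet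

lemma sp_coercive {r : ℕ} (a : ℝ) (ha : 0 < a) (φ : (Fin r → ℝ) → ℂ)
    (hφ : ContinuousOn φ (Set.Icc (fun _ : Fin r => -a) (fun _ => a)))
    (H : Matrix (Fin r) (Fin r) ℂ) (hpd : (H.map Complex.re).PosDef)
    (hT : ∀ ε > 0, ∃ δ > 0, ∀ t : Fin r → ℝ, ‖t‖ < δ →
      ‖φ t - (1 / 2) * spQ H t‖ ≤ ε * ‖t‖ ^ 2)
    (hmin : ∀ t ∈ Set.Icc (fun _ : Fin r => -a) (fun _ => a), t ≠ 0 → 0 < (φ t).re) :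
    ∃ c > 0, ∀ t ∈ Set.Icc (fun _ : Fin r => -a) (fun _ => a), c * ‖t‖ ^ 2 ≤ (φ t).re := by
  obtain ⟨m, hm, hmb⟩ := (isCompact_sphere (0 : Fin r → ℝ) 1).exists_forall_le' (a := 0)
    (f := fun t => (spQ H t).re) (Complex.continuous_re.comp (spQ_cont H)).continuousOn
    (by
      intro t ht
      have ht0 : t ≠ 0 := by rintro rfl; simp at ht
      have := hpd.dotProduct_mulVec_pos ht0
      simp only [star_trivial] at this
      rwa [spQ_re])
  have hquad : ∀ t : Fin r → ℝ, m * ‖t‖ ^ 2 ≤ (spQ H t).re := by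
    intro t
    rcases eq_or_ne t 0 with rfl | ht
    · rw [spQ_re]; simp
    have htn : 0 < ‖t‖ := norm_pos_iff.2 ht
    have h1 := hmb (‖t‖⁻¹ • t) (by simp [norm_smul, htn.ne'])
    simp only [spQ_smul] at h1
    rw [← Complex.ofReal_pow, Complex.re_ofReal_mul, inv_pow] at h1
    rw [inv_mul_eq_div, le_div_iff₀ (by positivity)] at h1
    exact h1
  obtain ⟨δ, hδ, hb⟩ := hT (m / 4) (by positivity)
  have hcomp : IsCompact (Set.Icc (fun _ : Fin r => -a) (fun _ => a) ∩ {t | δ ≤ ‖t‖}) :=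
    isCompact_Icc.inter_right (isClosed_le continuous_const continuous_norm)
  obtain ⟨m', hm', hmb'⟩ := hcomp.exists_forall_le' (a := 0) (f := fun t => (φ t).re)
    (Complex.continuous_re.comp_continuousOn (hφ.mono Set.inter_subset_left))
    (by
      rintro t ⟨ht, ht2⟩
      refine hmin t ht ?_
      rintro rfl
      simp at ht2; linarith)
  refine ⟨min (m / 4) (m' / a ^ 2), lt_min (by positivity) (by positivity), fun t ht => ?_⟩
  rcases lt_or_ge ‖t‖ δ with h | h
  · have h1 := (Complex.abs_re_le_norm _).trans (hb t h)
    have h4 : ((φ t) - 1 / 2 * spQ H t).re = (φ t).re - 1 / 2 * (spQ H t).re := by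
      rw [Complex.sub_re, show (1 / 2 : ℂ) = ((1 / 2 : ℝ) : ℂ) by norm_num, Complex.re_ofReal_mul]
    rw [h4] at h1
    have h5 := (abs_le.1 h1).1
    have h6 := hquad t
    have h7 : min (m / 4) (m' / a ^ 2) * ‖t‖ ^ 2 ≤ m / 4 * ‖t‖ ^ 2 :=
      mul_le_mul_of_nonneg_right (min_le_left _ _) (by positivity)
    linarith
  · have h1 := hmb' t ⟨ht, h⟩
    have h2 := sp_cube_norm a ha t ht
    calc _ ≤ m' / a ^ 2 * ‖t‖ ^ 2 :=
          mul_le_mul_of_nonneg_right (min_le_right _ _) (by positivity)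
      _ ≤ m' / a ^ 2 * a ^ 2 := by gcongr
      _ = m' := by field_simp
      _ ≤ _ := h1

lemma sp_laplace {r : ℕ} (a : ℝ) (ha : 0 < a) (φ g : (Fin r → ℝ) → ℂ)
    (hφ : ContinuousOn φ (Set.Icc (fun _ : Fin r => -a) (fun _ => a)))
    (hg : ContinuousOn g (Set.Icc (fun _ : Fin r => -a) (fun _ => a)))
    (H : Matrix (Fin r) (Fin r) ℂ)
    (hT : ∀ ε > 0, ∃ δ > 0, ∀ t : Fin r → ℝ, ‖t‖ < δ →
      ‖φ t - (1 / 2) * spQ H t‖ ≤ ε * ‖t‖ ^ 2)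
    (c : ℝ) (hc : 0 < c)
    (hco : ∀ t ∈ Set.Icc (fun _ : Fin r => -a) (fun _ => a), c * ‖t‖ ^ 2 ≤ (φ t).re) :
    Tendsto (fun n : ℕ => ((Real.sqrt n ^ r : ℝ) : ℂ) *
      ∫ t in Set.Icc (fun _ : Fin r => -a) (fun _ => a), Complex.exp (-(n : ℂ) * φ t) * g t)
      atTop (nhds (∫ s : Fin r → ℝ, Complex.exp (-(1 / 2) * spQ H s) * g 0)) := by
  set K := Set.Icc (fun _ : Fin r => -a) (fun _ => a) with hK
  have hKm : MeasurableSet K := measurableSet_Icc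
  obtain ⟨M, hM⟩ := isCompact_Icc.exists_bound_of_continuousOn hg
  set F : ℕ → (Fin r → ℝ) → ℂ := fun n =>
    K.indicator (fun t => Complex.exp (-(n : ℂ) * φ t) * g t) with hF
  have hscale : ∀ n : ℕ, 0 < n → ∫ s, F n ((Real.sqrt n)⁻¹ • s) = ((Real.sqrt n ^ r : ℝ) : ℂ) *
      ∫ t in K, Complex.exp (-(n : ℂ) * φ t) * g t := by
    intro n hn
    rw [Measure.integral_comp_smul, hF, integral_indicator hKm, Complex.real_smul]
    congr 2
    rw [abs_of_nonneg (by positivity)]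
    simp
  have hsq : ∀ n : ℕ, Real.sqrt n ^ 2 = n := fun n => Real.sq_sqrt (Nat.cast_nonneg n)
  have hlim0 : Tendsto (fun n : ℕ => (Real.sqrt n)⁻¹) atTop (nhds 0) :=
    tendsto_inv_atTop_zero.comp (Real.tendsto_sqrt_atTop.comp tendsto_natCast_atTop_atTop)
  have h0K : (0 : Fin r → ℝ) ∈ K := sp_mem_cube a 0 (by simpa using ha.le)
  have hDCT : Tendsto (fun n : ℕ => ∫ s, F n ((Real.sqrt n)⁻¹ • s)) atTop
      (nhds (∫ s : Fin r → ℝ, Complex.exp (-(1 / 2) * spQ H s) * g 0)) := by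
    refine tendsto_integral_filter_of_dominated_convergence
      (fun s => Real.exp (-(c * ‖s‖ ^ 2)) * M) ?_ ?_ ((sp_integrable c hc).mul_const M) ?_
    · filter_upwards [eventually_gt_atTop 0] with n hn
      have hmeas : Measurable (F n) := by
        classical
        rw [hF]
        simp only [← Set.piecewise_eq_indicator]
        refine ContinuousOn.measurable_piecewise ?_ continuousOn_const hKm
        exact (Complex.continuous_exp.comp_continuousOn (continuousOn_const.mul hφ)).mul hg
      exact (hmeas.comp (measurable_const_smul _)).aestronglyMeasurable
    · filter_upwards [eventually_gt_atTop 0] with n hn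
      refine Eventually.of_forall fun s => ?_
      have hn' : (0 : ℝ) < n := by exact_mod_cast hn
      by_cases hs : (Real.sqrt n)⁻¹ • s ∈ K
      · simp only [hF]
        rw [Set.indicator_of_mem hs, norm_mul, Complex.norm_exp]
        have h1 := hco _ hs
        rw [norm_smul, Real.norm_of_nonneg (by positivity), mul_pow, inv_pow, hsq] at h1
        have h2 : (-(n : ℂ) * φ ((Real.sqrt n)⁻¹ • s)).re = -(n * (φ ((Real.sqrt n)⁻¹ • s)).re) := by
          simp
        have h3 : c * ‖s‖ ^ 2 ≤ n * (φ ((Real.sqrt n)⁻¹ • s)).re := by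
          calc c * ‖s‖ ^ 2 = n * (c * ((n : ℝ)⁻¹ * ‖s‖ ^ 2)) := by field_simp
            _ ≤ _ := mul_le_mul_of_nonneg_left h1 hn'.le
        rw [h2]
        refine mul_le_mul (Real.exp_le_exp.2 (by linarith)) (hM _ hs) (norm_nonneg _)
          (Real.exp_pos _).le
      · simp only [hF]
        rw [Set.indicator_of_notMem hs, norm_zero]
        have : 0 ≤ M := (norm_nonneg _).trans (hM 0 h0K)
        positivity
    · refine Eventually.of_forall fun s => ?_
      have hts : Tendsto (fun n : ℕ => (Real.sqrt n)⁻¹ • s) atTop (nhds 0) := by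
        simpa using hlim0.smul_const s
      have hevK : ∀ᶠ n : ℕ in atTop, (Real.sqrt n)⁻¹ • s ∈ K := by
        have := hts.norm.eventually_lt_const (u := a) (by simpa using ha)
        filter_upwards [this] with n hn using sp_mem_cube a _ hn.le
      have hgl : Tendsto (fun n : ℕ => g ((Real.sqrt n)⁻¹ • s)) atTop (nhds (g 0)) :=
        (hg 0 h0K).tendsto.comp (tendsto_nhdsWithin_iff.2 ⟨hts, hevK⟩)
      have hφl : Tendsto (fun n : ℕ => -(n : ℂ) * φ ((Real.sqrt n)⁻¹ • s)) atTop
          (nhds (-(1 / 2) * spQ H s)) := by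
        rw [tendsto_iff_norm_sub_tendsto_zero, Metric.tendsto_nhds]
        intro ε hε
        obtain ⟨δ, hδ, hb⟩ := hT (ε / (2 * (‖s‖ ^ 2 + 1))) (by positivity)
        have := hts.norm.eventually_lt_const (u := δ) (by simpa using hδ)
        filter_upwards [this, eventually_gt_atTop 0] with n hn hn0
        have hn' : (0 : ℝ) < n := by exact_mod_cast hn0
        have hnc : (n : ℂ) ≠ 0 := by exact_mod_cast hn0.ne'
        have h1 := hb _ hn
        rw [spQ_smul, norm_smul, Real.norm_of_nonneg (by positivity), mul_pow, inv_pow, hsq,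
          ← Complex.ofReal_pow, inv_pow, hsq] at h1
        have h2 : -(n : ℂ) * φ ((Real.sqrt n)⁻¹ • s) - -(1 / 2) * spQ H s
            = -(n : ℂ) * (φ ((Real.sqrt n)⁻¹ • s) - 1 / 2 * (((n : ℝ)⁻¹ : ℝ) * spQ H s)) := by
          push_cast
          field_simp
          ring
        rw [dist_zero_right, norm_norm, h2, norm_mul, norm_neg, Complex.norm_natCast]
        calc _ ≤ (n : ℝ) * (ε / (2 * (‖s‖ ^ 2 + 1)) * ((n : ℝ)⁻¹ * ‖s‖ ^ 2)) :=
              mul_le_mul_of_nonneg_left h1 hn'.le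
          _ = ε / (2 * (‖s‖ ^ 2 + 1)) * ‖s‖ ^ 2 := by field_simp
          _ < ε := by
            rw [div_mul_eq_mul_div, div_lt_iff₀ (by positivity)]
            nlinarith [sq_nonneg ‖s‖, mul_nonneg hε.le (sq_nonneg ‖s‖)]
      have hlim := (Complex.continuous_exp.continuousAt.tendsto.comp hφl).mul hgl
      refine hlim.congr' ?_
      filter_upwards [hevK] with n hn
      simp only [hF]
      rw [Set.indicator_of_mem hn]
      rfl
  refine hDCT.congr' ?_
  filter_upwards [eventually_gt_atTop 0] with n hn using hscale n hn

/-- Multivariate saddle point method: let `p, q` be holomorphic on an open set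
`D ⊆ ℂ^r` containing the real cube `[-a,a]^r`, let `t = 0` be a simple saddle point of `p`
(vanishing complex gradient, nonsingular complex Hessian), suppose `Re p` attains its
minimum on the cube only at `t = 0`, that the real part of the Hessian is nonsingular and
`q(0) ≠ 0`. Then `I(n) = ∫_{[-a,a]^r} e^{-n p(t)} q(t) dt` satisfies
`I(n) ∼ (2π/n)^{r/2} e^{-n p(0)} q(0)/w` with `w² = det Hess p(0)`. -/
theorem stmt_0 (r : ℕ) (hr : 0 < r) (a : ℝ) (ha : 0 < a)
    (D : Set (Fin r → ℂ)) (hD : IsOpen D)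
    (hcube : ∀ t : Fin r → ℝ, t ∈ Set.Icc (fun _ => -a) (fun _ => a) →
      (fun j => (t j : ℂ)) ∈ D)
    (p q : (Fin r → ℂ) → ℂ)
    (hp : DifferentiableOn ℂ p D) (hq : DifferentiableOn ℂ q D)
    (hgrad : ∀ j : Fin r, fderiv ℂ p 0 (Pi.single j 1) = 0)
    (Hess : Matrix (Fin r) (Fin r) ℂ)
    (hHess : ∀ i j : Fin r,
      Hess i j = fderiv ℂ (fun x => fderiv ℂ p x (Pi.single j 1)) 0 (Pi.single i 1))
    (hdet : Hess.det ≠ 0)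
    (hmin : ∀ t : Fin r → ℝ, t ∈ Set.Icc (fun _ => -a) (fun _ => a) → t ≠ 0 →
      (p 0).re < (p (fun j => (t j : ℂ))).re)
    (hredet : (Hess.map Complex.re).det ≠ 0)
    (hq0 : q 0 ≠ 0) :
    ∃ w : ℂ, w ^ 2 = Hess.det ∧
      Filter.Tendsto (fun n : ℕ =>
        (∫ t in Set.Icc (fun _ => -a) (fun _ : Fin r => a),
            Complex.exp (-(n : ℂ) * p (fun j => (t j : ℂ))) * q (fun j => (t j : ℂ))) /
        ((((2 * Real.pi / n) ^ ((r : ℝ) / 2) : ℝ) : ℂ) *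
          Complex.exp (-(n : ℂ) * p 0) * q 0 / w))
        Filter.atTop (nhds 1) := by
  have h0D : (0 : Fin r → ℂ) ∈ D := by
    have := hcube 0 (sp_mem_cube a 0 (by simpa using ha.le))
    simpa [Pi.zero_def] using this
  obtain ⟨hsymm, htay⟩ := sp_taylor D hD p hp h0D hgrad Hess hHess
  set ι : (Fin r → ℝ) → (Fin r → ℂ) := fun t j => (t j : ℂ) with hι
  have hι0 : ι 0 = 0 := by ext j; simp [hι]
  have hιc : Continuous ι := by rw [hι]; fun_prop
  have hιn : ∀ t, ‖ι t‖ = ‖t‖ := by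
    intro t
    simp [hι, Pi.norm_def]
  have hmaps : Set.MapsTo ι (Set.Icc (fun _ : Fin r => -a) (fun _ => a)) D := fun t ht =>
    hcube t ht
  have hφc : ContinuousOn (fun t => p (ι t) - p 0)
      (Set.Icc (fun _ : Fin r => -a) (fun _ => a)) :=
    (hp.continuousOn.comp hιc.continuousOn hmaps).sub continuousOn_const
  have hgc : ContinuousOn (fun t => q (ι t)) (Set.Icc (fun _ : Fin r => -a) (fun _ => a)) :=
    hq.continuousOn.comp hιc.continuousOn hmaps
  have hT : ∀ ε > 0, ∃ δ > 0, ∀ t : Fin r → ℝ, ‖t‖ < δ →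
      ‖(p (ι t) - p 0) - (1 / 2) * spQ Hess t‖ ≤ ε * ‖t‖ ^ 2 := by
    intro ε hε
    obtain ⟨δ, hδ, hb⟩ := htay ε hε
    refine ⟨δ, hδ, fun t ht => ?_⟩
    have := hb (ι t) (by rwa [hιn])
    rwa [hιn] at this
  have hmin' : ∀ t ∈ Set.Icc (fun _ : Fin r => -a) (fun _ => a), t ≠ 0 →
      0 < (p (ι t) - p 0).re := by
    intro t ht ht0
    rw [Complex.sub_re]
    linarith [hmin t ht ht0]
  have hpd := sp_posdef a ha (fun t => p (ι t) - p 0) Hess hsymm hredet hT hmin'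
  obtain ⟨c, hc, hco⟩ := sp_coercive a ha (fun t => p (ι t) - p 0) hφc Hess hpd hT hmin'
  have hlim := sp_laplace a ha (fun t => p (ι t) - p 0) (fun t => q (ι t)) hφc hgc Hess hT c hc hco
  have hgauss := sp_gauss Hess hsymm hpd
  rw [integral_mul_const] at hlim
  simp only [hι0] at hlim
  change (∫ s : Fin r → ℝ, Complex.exp (-(1 / 2) * spQ Hess s)) ^ 2 * Hess.det = _ at hgauss
  set J := ∫ s : Fin r → ℝ, Complex.exp (-(1 / 2) * spQ Hess s) with hJ
  have hpi : (0 : ℝ) < 2 * Real.pi := by positivity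
  have hpine : ((Real.sqrt (2 * Real.pi) : ℝ) : ℂ) ≠ 0 := by
    exact_mod_cast (Real.sqrt_pos.2 hpi).ne'
  have hJ0 : J ≠ 0 := by
    intro h
    rw [h, zero_pow two_ne_zero, zero_mul] at hgauss
    have : ((2 * Real.pi : ℝ) : ℂ) ≠ 0 := by exact_mod_cast hpi.ne'
    refine pow_ne_zero r this ?_
    rw [hgauss]; push_cast; rfl
  refine ⟨((Real.sqrt (2 * Real.pi) : ℝ) : ℂ) ^ r / J, ?_, ?_⟩
  · rw [div_pow, div_eq_iff (pow_ne_zero 2 hJ0), mul_comm Hess.det, hgauss, ← pow_mul, mul_comm r,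
      pow_mul, ← Complex.ofReal_pow, Real.sq_sqrt hpi.le]
    push_cast; rfl
  have hfin := hlim.div_const (J * q 0)
  rw [div_self (mul_ne_zero hJ0 hq0)] at hfin
  refine hfin.congr' ?_
  filter_upwards [eventually_gt_atTop 0] with n hn
  have hn' : (0 : ℝ) < n := by exact_mod_cast hn
  have hpow : (2 * Real.pi / n) ^ ((r : ℝ) / 2) = Real.sqrt (2 * Real.pi) ^ r / Real.sqrt n ^ r := by
    rw [← div_pow, ← Real.sqrt_div hpi.le, Real.sqrt_eq_rpow, ← Real.rpow_natCast,
      ← Real.rpow_mul (by positivity)]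
    congr 1; ring
  have hint : ∫ t in Set.Icc (fun _ : Fin r => -a) (fun _ => a),
      Complex.exp (-(n : ℂ) * (p (ι t) - p 0)) * q (ι t)
      = (Complex.exp (-(n : ℂ) * p 0))⁻¹ * ∫ t in Set.Icc (fun _ : Fin r => -a) (fun _ => a),
        Complex.exp (-(n : ℂ) * p (ι t)) * q (ι t) := by
    rw [← integral_const_mul]
    congr 1
    ext t
    rw [← mul_assoc, ← Complex.exp_neg, ← Complex.exp_add]
    congr 2; ring
  have hsn : ((Real.sqrt n : ℝ) : ℂ) ≠ 0 := by
    exact_mod_cast (Real.sqrt_pos.2 hn').ne'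
  have he := Complex.exp_ne_zero (-(n : ℂ) * p 0)
  rw [hint, hpow]
  change _ = (∫ t in Set.Icc (fun _ : Fin r => -a) (fun _ => a),
        Complex.exp (-(n : ℂ) * p (ι t)) * q (ι t)) / _
  push_cast
  field_simp
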